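/- Let (I,J,K) be a triple of r-element subsets of {1,…,n} having property Pₙ, let i₀=j₀=k₀=0, and suppose u,v,w ∈ {0,…,r} satisfy i_u + j_v + k_w ≤ n. Define i'_y = i_y + [y > u], j'_y = j_y + [y > v], k'_y = k_y + [y > w]. Then the triple (I',J',K') of subsets of {1,…,n+1} has property P_{n+1}. -/

import Mathlib

open scoped ComplexOrder

namespace Paper

variable {H : Type} [NormedAddCommGroup H] [InnerProductSpace ℂ H] [CompleteSpace H]

/-- `p` is an (orthogonal) projection operator. -/
def IsProj (p : H →L[ℂ] H) : Prop := IsIdempotentElem p ∧ IsSelfAdjoint p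

/-- `p` is a projection belonging to the von Neumann algebra `M`. -/
def IsProjection (M : VonNeumannAlgebra H) (p : H →L[ℂ] H) : Prop :=
  p ∈ M ∧ IsProj p

/-- The range of an operator, as a submodule. -/
def rng (p : H →L[ℂ] H) : Submodule ℂ H := LinearMap.range p.toLinearMap

/-- `r` is the lattice meet `p ∧ q` of projections: the orthogonal projection onto `pH ∩ qH`. -/
def IsMeetOf (r p q : H →L[ℂ] H) : Prop := IsProj r ∧ rng r = rng p ⊓ rng q

/-- `r` is the lattice join `p ∨ q` of projections:
the orthogonal projection onto the closure of `pH + qH`. -/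
def IsJoinOf (r p q : H →L[ℂ] H) : Prop :=
  IsProj r ∧ rng r = (rng p ⊔ rng q).topologicalClosure

/-- A faithful tracial state on a von Neumann algebra, making it a finite von Neumann algebra. -/
structure TracialState (M : VonNeumannAlgebra H) where
  τ : (H →L[ℂ] H) → ℂ
  map_add : ∀ a b : H →L[ℂ] H, τ (a + b) = τ a + τ b
  map_smul : ∀ (c : ℂ) (a : H →L[ℂ] H), τ (c • a) = c * τ a
  tracial : ∀ a b : H →L[ℂ] H, a ∈ M → b ∈ M → τ (a * b) = τ (b * a)
  pos : ∀ a : H →L[ℂ] H, a ∈ M → 0 ≤ τ (star a * a)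
  faithful : ∀ a : H →L[ℂ] H, a ∈ M → τ (star a * a) = 0 → a = 0
  normalized : τ 1 = 1

/-- `M` is diffuse: it has no minimal nonzero projections. -/
def Diffuse (M : VonNeumannAlgebra H) : Prop :=
  ∀ p : H →L[ℂ] H, IsProjection M p → p ≠ 0 →
    ∃ q : H →L[ℂ] H, IsProjection M q ∧ rng q ≤ rng p ∧ q ≠ 0 ∧ q ≠ p

end Paper

namespace Paper

variable {H : Type} [NormedAddCommGroup H] [InnerProductSpace ℂ H] [CompleteSpace H]

/-- A flag in `(M,τ)`: an increasing family `(e_t)_{0≤t≤1}` of projections with `τ(e_t) = t`. -/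
def IsFlag (M : VonNeumannAlgebra H) (T : TracialState M) (e : ℝ → (H →L[ℂ] H)) : Prop :=
  (∀ t ∈ Set.Icc (0:ℝ) 1, IsProjection M (e t)) ∧
  (∀ s ∈ Set.Icc (0:ℝ) 1, ∀ t ∈ Set.Icc (0:ℝ) 1, s ≤ t → rng (e s) ≤ rng (e t)) ∧
  (∀ t ∈ Set.Icc (0:ℝ) 1, T.τ (e t) = ((t : ℝ) : ℂ))

/-- Property `Pₙ` for a triple of `r`-subsets of `{1,…,n}`, given by the indexing functions
`i, j, k` (1-indexed, increasing): for all flags `e, f, g` in any finite von Neumann algebra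
`(M,τ)` there is a projection `p` with `τ(p) = r/n` and
`τ(e_{i_ℓ/n} ∧ p) ≥ ℓ/n`, `τ(f_{j_ℓ/n} ∧ p) ≥ ℓ/n`, `τ(g_{k_ℓ/n} ∧ p) ≥ ℓ/n`
for all `ℓ ∈ {1,…,r}`. -/
def PropertyP (n r : ℕ) (i j k : ℕ → ℕ) : Prop :=
  ∀ (H' : Type) [NormedAddCommGroup H'] [InnerProductSpace ℂ H'] [CompleteSpace H']
    (M : VonNeumannAlgebra H') (T : TracialState M) (e f g : ℝ → (H' →L[ℂ] H')),
    IsFlag M T e → IsFlag M T f → IsFlag M T g →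
    ∃ p : H' →L[ℂ] H', IsProjection M p ∧ T.τ p = (((r : ℝ) / n : ℝ) : ℂ) ∧
      ∀ ℓ : ℕ, 1 ≤ ℓ → ℓ ≤ r →
        (∃ q, q ∈ M ∧ IsMeetOf q (e ((i ℓ : ℝ) / n)) p ∧ (((ℓ : ℝ) / n : ℝ) : ℂ) ≤ T.τ q) ∧
        (∃ q, q ∈ M ∧ IsMeetOf q (f ((j ℓ : ℝ) / n)) p ∧ (((ℓ : ℝ) / n : ℝ) : ℂ) ≤ T.τ q) ∧
        (∃ q, q ∈ M ∧ IsMeetOf q (g ((k ℓ : ℝ) / n)) p ∧ (((ℓ : ℝ) / n : ℝ) : ℂ) ≤ T.τ q)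

/-- Property `APₙ`: the approximate version of property `Pₙ`, where the projection `p`
satisfies `τ(p) ≤ r/n + ε` for a given `ε > 0`. -/
def PropertyAP (n r : ℕ) (i j k : ℕ → ℕ) : Prop :=
  ∀ (H' : Type) [NormedAddCommGroup H'] [InnerProductSpace ℂ H'] [CompleteSpace H']
    (M : VonNeumannAlgebra H') (T : TracialState M) (e f g : ℝ → (H' →L[ℂ] H')),
    IsFlag M T e → IsFlag M T f → IsFlag M T g →
    ∀ ε : ℝ, 0 < ε →
    ∃ p : H' →L[ℂ] H', IsProjection M p ∧ T.τ p ≤ (((r : ℝ) / n + ε : ℝ) : ℂ) ∧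
      ∀ ℓ : ℕ, 1 ≤ ℓ → ℓ ≤ r →
        (∃ q, q ∈ M ∧ IsMeetOf q (e ((i ℓ : ℝ) / n)) p ∧ (((ℓ : ℝ) / n : ℝ) : ℂ) ≤ T.τ q) ∧
        (∃ q, q ∈ M ∧ IsMeetOf q (f ((j ℓ : ℝ) / n)) p ∧ (((ℓ : ℝ) / n : ℝ) : ℂ) ≤ T.τ q) ∧
        (∃ q, q ∈ M ∧ IsMeetOf q (g ((k ℓ : ℝ) / n)) p ∧ (((ℓ : ℝ) / n : ℝ) : ℂ) ≤ T.τ q)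

end Paper

namespace Paper

variable {H : Type} [NormedAddCommGroup H] [InnerProductSpace ℂ H] [CompleteSpace H]

lemma IsProj.mem_rng_iff {p : H →L[ℂ] H} (hp : IsProj p) {x : H} : x ∈ rng p ↔ p x = x := by
  constructor
  · rintro ⟨y, rfl⟩
    exact congr($(hp.1.eq) y)
  · intro h
    exact ⟨x, h⟩

lemma rng_le_iff {p q : H →L[ℂ] H} (hq : IsProj q) : rng p ≤ rng q ↔ q * p = p := by
  constructor
  · intro h
    ext x
    exact hq.mem_rng_iff.1 (h ⟨x, rfl⟩)
  · rintro h _ ⟨y, rfl⟩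
    exact hq.mem_rng_iff.2 congr($h y)

lemma IsProj.mul_comm_of_mul_eq {p q : H →L[ℂ] H} (hp : IsProj p) (hq : IsProj q)
    (h : q * p = p) : p * q = p := by
  simpa [hp.2.star_eq, hq.2.star_eq] using congr(star $h)

lemma IsProj.one_sub {p : H →L[ℂ] H} (hp : IsProj p) : IsProj (1 - p) :=
  ⟨hp.1.one_sub, by simpa using (IsSelfAdjoint.one _).sub hp.2⟩

lemma IsProj.sub {p q : H →L[ℂ] H} (hp : IsProj p) (hq : IsProj q) (h : q * p = p) :
    IsProj (q - p) := by
  refine ⟨?_, hq.2.sub hp.2⟩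
  have h' := hp.mul_comm_of_mul_eq hq h
  simp only [IsIdempotentElem, mul_sub, sub_mul, hp.1.eq, hq.1.eq, h, h']
  abel

lemma isProj_starProjection (K : Submodule ℂ H) [K.HasOrthogonalProjection] :
    IsProj K.starProjection :=
  ⟨K.isIdempotentElem_starProjection, isSelfAdjoint_starProjection K⟩

lemma rng_starProjection {E : Type} [NormedAddCommGroup E] [InnerProductSpace ℂ E]
    (K : Submodule ℂ E) [K.HasOrthogonalProjection] :
    rng K.starProjection = K :=
  K.range_starProjection

lemma IsProj.isClosed_rng {p : H →L[ℂ] H} (hp : IsProj p) : IsClosed (rng p : Set H) := by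
  have : (rng p : Set H) = {x | p x = x} := by
    ext x
    exact hp.mem_rng_iff
  rw [this]
  exact isClosed_eq p.continuous continuous_id

lemma IsProj.mem_of_invariant {M : VonNeumannAlgebra H} {p : H →L[ℂ] H} (hp : IsProj p)
    (h : ∀ y ∈ M.commutant, ∀ x ∈ rng p, y x ∈ rng p) : p ∈ M := by
  rw [VonNeumannAlgebra.IsStarProjection.mem_iff ⟨hp.1, hp.2⟩]
  exact h

lemma apply_comm_of_mem_commutant {M : VonNeumannAlgebra H} {a y : H →L[ℂ] H} (ha : a ∈ M)
    (hy : y ∈ M.commutant) (x : H) : a (y x) = y (a x) :=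
  congr($(VonNeumannAlgebra.mem_commutant_iff.1 hy a ha) x)

/-- The meet `p ∧ q` of two projections. -/
noncomputable def meet (p q : H →L[ℂ] H) : H →L[ℂ] H :=
  (rng p ⊓ rng q).topologicalClosure.starProjection

lemma isProj_meet (p q : H →L[ℂ] H) : IsProj (meet p q) := isProj_starProjection _

lemma rng_meet {p q : H →L[ℂ] H} (hp : IsProj p) (hq : IsProj q) :
    rng (meet p q) = rng p ⊓ rng q := by
  rw [meet, rng_starProjection]
  exact IsClosed.submodule_topologicalClosure_eq (hp.isClosed_rng.inter hq.isClosed_rng)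

lemma IsProjection.meet {M : VonNeumannAlgebra H} {p q : H →L[ℂ] H} (hp : IsProjection M p)
    (hq : IsProjection M q) : IsProjection M (meet p q) := by
  refine ⟨(isProj_meet p q).mem_of_invariant fun y hy x hx => ?_, isProj_meet p q⟩
  rw [rng_meet hp.2 hq.2, Submodule.mem_inf, hp.2.mem_rng_iff, hq.2.mem_rng_iff] at hx ⊢
  rw [apply_comm_of_mem_commutant hp.1 hy, apply_comm_of_mem_commutant hq.1 hy, hx.1, hx.2]
  exact ⟨rfl, rfl⟩

lemma IsProjection.one_sub {M : VonNeumannAlgebra H} {p : H →L[ℂ] H} (hp : IsProjection M p) :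
    IsProjection M (1 - p) :=
  ⟨sub_mem (one_mem M) hp.1, hp.2.one_sub⟩

/-- A self-adjoint element of a von Neumann algebra is the product of a symmetry of the algebra
and its absolute value. -/
lemma exists_symmetry_mul_abs {M : VonNeumannAlgebra H} {b : H →L[ℂ] H} (hb : b ∈ M)
    (hsa : IsSelfAdjoint b) :
    ∃ s ∈ M, IsSelfAdjoint s ∧ s * s = 1 ∧ s * b = CFC.abs b ∧ b * s = CFC.abs b := by
  have hneg : IsSelfAdjoint b⁻ := (CFC.negPart_nonneg b).isSelfAdjoint
  have hpos : IsSelfAdjoint b⁺ := (CFC.posPart_nonneg b).isSelfAdjoint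
  have hclosed : IsClosed (LinearMap.ker (b⁻).toLinearMap : Set H) :=
    isClosed_eq (b⁻).continuous continuous_const
  have : CompleteSpace (LinearMap.ker (b⁻).toLinearMap) := hclosed.completeSpace_coe
  set F := (LinearMap.ker (b⁻).toLinearMap).starProjection with hF
  have hFp : IsProj F := isProj_starProjection _
  have hmem (x : H) : x ∈ rng F ↔ b⁻ x = 0 := by
    rw [hF, rng_starProjection]; exact LinearMap.mem_ker
  have hFM : F ∈ M := hFp.mem_of_invariant fun y hy x hx => by
    rw [hmem] at hx ⊢
    have hc : Commute b y := VonNeumannAlgebra.mem_commutant_iff.1 hy b hb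
    have hc' : Commute b⁻ y := by rw [CFC.negPart_def]; exact hc.cfcₙ_real _
    have := congr($(hc'.eq) x)
    simpa [hx] using this
  have h1 : F * b⁺ = b⁺ := by
    ext x
    refine hFp.mem_rng_iff.1 ((hmem _).2 ?_)
    exact congr($(CFC.negPart_mul_posPart b) x)
  have h2 : b⁻ * F = 0 := by
    ext x
    exact (hmem _).1 ⟨x, rfl⟩
  have h1' : b⁺ * F = b⁺ := by
    simpa [hFp.2.star_eq, hpos.star_eq] using congr(star $h1)
  have h2' : F * b⁻ = 0 := by
    simpa [hFp.2.star_eq, hneg.star_eq] using congr(star $h2)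
  have hdec := CFC.posPart_sub_negPart b hsa
  have habs := CFC.posPart_add_negPart b hsa
  refine ⟨F + F - 1, sub_mem (add_mem hFM hFM) (one_mem M),
    (hFp.2.add hFp.2).sub (IsSelfAdjoint.one _), ?_, ?_, ?_⟩
  · simp only [sub_mul, mul_sub, add_mul, mul_add, hFp.1.eq, mul_one, one_mul]
    abel
  · rw [← habs]
    nth_rw 1 [← hdec]
    simp only [sub_mul, mul_sub, add_mul, h1, h2', one_mul]
    abel
  · rw [← habs]
    nth_rw 1 [← hdec]
    simp only [sub_mul, mul_sub, mul_add, h1', h2, mul_one]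
    abel

namespace TracialState

variable {M : VonNeumannAlgebra H} (T : TracialState M)

lemma map_sub (a b : H →L[ℂ] H) : T.τ (a - b) = T.τ a - T.τ b := by
  have h := T.map_add (a - b) b
  rw [sub_add_cancel] at h
  rw [h, add_sub_cancel_right]

/-- The trace of a projection, as a real number. -/
def tr (p : H →L[ℂ] H) : ℝ := (T.τ p).re

lemma tr_sub (a b : H →L[ℂ] H) : T.tr (a - b) = T.tr a - T.tr b := by simp [tr, map_sub]

lemma tr_one : T.tr 1 = 1 := by simp [tr, T.normalized]

variable {T}

lemma τ_nonneg {p : H →L[ℂ] H} (hp : IsProjection M p) : 0 ≤ T.τ p := by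
  simpa [hp.2.2.star_eq, hp.2.1.eq] using T.pos p hp.1

lemma tr_nonneg {p : H →L[ℂ] H} (hp : IsProjection M p) : 0 ≤ T.tr p :=
  (Complex.nonneg_iff.1 (τ_nonneg hp)).1

lemma τ_eq_tr {p : H →L[ℂ] H} (hp : IsProjection M p) : T.τ p = (T.tr p : ℂ) :=
  Complex.ext rfl (Complex.nonneg_iff.1 (τ_nonneg (T := T) hp)).2.symm

lemma tr_mono {p q : H →L[ℂ] H} (hp : IsProjection M p) (hq : IsProjection M q)
    (h : rng p ≤ rng q) : T.tr p ≤ T.tr q := by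
  have := tr_nonneg (T := T) ⟨sub_mem hq.1 hp.1, hp.2.sub hq.2 ((rng_le_iff hq.2).1 h)⟩
  rw [tr_sub] at this
  linarith

lemma eq_of_rng_le_of_tr_le {p q : H →L[ℂ] H} (hp : IsProjection M p) (hq : IsProjection M q)
    (h : rng p ≤ rng q) (ht : T.tr q ≤ T.tr p) : p = q := by
  have hd : IsProjection M (q - p) :=
    ⟨sub_mem hq.1 hp.1, hp.2.sub hq.2 ((rng_le_iff hq.2).1 h)⟩
  have h0 : T.tr (q - p) = 0 :=
    le_antisymm (by rw [tr_sub]; linarith) (tr_nonneg hd)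
  have := T.faithful (q - p) hd.1 (by
    rw [hd.2.2.star_eq, hd.2.1.eq, τ_eq_tr hd, h0, Complex.ofReal_zero])
  exact (sub_eq_zero.1 this).symm

lemma tr_add_sub_one_le_tr_meet {p q : H →L[ℂ] H} (hp : IsProjection M p)
    (hq : IsProjection M q) : T.tr p + T.tr q - 1 ≤ T.tr (meet p q) := by
  obtain ⟨s, hsM, hsa, hss, hsb, hbs⟩ :=
    exists_symmetry_mul_abs (sub_mem hp.1 hq.1) (hp.2.2.sub hq.2.2)
  have hbsa : IsSelfAdjoint (p - q) := hp.2.2.sub hq.2.2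
  set b := p - q with hb
  set m := meet p q with hm
  have hmp : IsProjection M m := hp.meet hq
  have hpm : p * m = m := (rng_le_iff hp.2).1 (by rw [hm, rng_meet hp.2 hq.2]; exact inf_le_left)
  have hmp' : m * p = m := hmp.2.mul_comm_of_mul_eq hp.2 hpm
  have hbp : b * p = (1 - q) * b := by
    simp only [hb, sub_mul, mul_sub, one_mul, hp.2.1.eq, hq.2.1.eq]
    abel
  have hpb : p * b = b * (1 - q) := by
    simpa [hbsa.star_eq, hp.2.2.star_eq, hq.2.2.star_eq] using congr(star $hbp)
  have hcomm : Commute (CFC.abs b) p := by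
    have h2 : Commute (star b * b) p := by
      rw [hbsa.star_eq, commute_iff_eq, mul_assoc, hbp, ← mul_assoc, ← mul_assoc, hpb]
    rw [CFC.abs, CFC.sqrt]
    exact h2.cfcₙ_nnreal _
  have hsabs : s * CFC.abs b = b := by rw [← hsb, ← mul_assoc, hss, one_mul]
  have habss : CFC.abs b * s = b := by rw [← hbs, mul_assoc, hss, mul_one]
  have hX : (s * p - (1 - q) * s) * b = 0 := by
    have : (s * p - (1 - q) * s) * CFC.abs b = 0 := by
      rw [sub_mul, mul_assoc, ← hcomm.eq, ← mul_assoc, hsabs, mul_assoc, hsabs, hbp, sub_self]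
    rw [← habss, ← mul_assoc, this, zero_mul]
  have hX' : b * (p * s - s * (1 - q)) = 0 := by
    simpa [hbsa.star_eq, hp.2.2.star_eq, hq.2.2.star_eq, hsa.star_eq] using congr(star $hX)
  have hY : (p - m) * (p * s - s * (1 - q)) = 0 := by
    set Y := p * s - s * (1 - q)
    have h1 : b * (p * Y) = 0 := by rw [← mul_assoc, hbp, mul_assoc, hX', mul_zero]
    have h2 : q * (p * Y) = p * Y := by
      rw [hb, sub_mul, ← mul_assoc p p, hp.2.1.eq, sub_eq_zero] at h1
      exact h1.symm
    have h3 : m * (p * Y) = p * Y := by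
      rw [← rng_le_iff hmp.2, hm, rng_meet hp.2 hq.2, le_inf_iff, rng_le_iff hp.2,
        rng_le_iff hq.2, h2, ← mul_assoc, hp.2.1.eq]
      exact ⟨rfl, rfl⟩
    rw [← mul_assoc, hmp'] at h3
    rw [sub_mul, h3, sub_self]
  have hd : IsProj (p - m) := hmp.2.sub hp.2 hpm
  have hd' : IsProjection M (s * (p - m) * s) := by
    refine ⟨mul_mem (mul_mem hsM (sub_mem hp.1 hmp.1)) hsM, ?_, ?_⟩
    · rw [IsIdempotentElem, mul_assoc (s * (p - m)), ← mul_assoc s _ s, ← mul_assoc s s, hss,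
        one_mul, ← mul_assoc, mul_assoc s, hd.1.eq]
    · rw [IsSelfAdjoint, star_mul, star_mul, hsa.star_eq, hd.2.star_eq, mul_assoc]
  have hle : (s * (p - m) * s) * (1 - q) = s * (p - m) * s := by
    have h1 : (p - m) * p = p - m := by rw [sub_mul, hp.2.1.eq, hmp']
    rw [mul_sub (p - m), ← mul_assoc, h1, sub_eq_zero] at hY
    rw [mul_assoc s, hY, mul_assoc, mul_assoc, mul_assoc s (1 - q), hq.2.one_sub.1.eq]
  have hle' : (1 - q) * (s * (p - m) * s) = s * (p - m) * s := by
    simpa [hd'.2.2.star_eq, hq.2.2.star_eq] using congr(star $hle)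
  have key := tr_mono (T := T) hd' hq.one_sub ((rng_le_iff hq.2.one_sub).2 hle')
  have htr : T.tr (s * (p - m) * s) = T.tr (p - m) := by
    rw [tr, T.tracial _ _ (mul_mem hsM (sub_mem hp.1 hmp.1)) hsM, ← mul_assoc, hss, one_mul, tr]
  rw [htr, tr_sub, tr_sub, tr_one] at key
  linarith

end TracialState

section Flag

variable {M : VonNeumannAlgebra H} {T : TracialState M} {e : ℝ → (H →L[ℂ] H)}

lemma IsFlag.tr_eq (he : IsFlag M T e) {t : ℝ} (ht : t ∈ Set.Icc (0 : ℝ) 1) :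
    T.tr (e t) = t := by
  rw [TracialState.tr, he.2.2 t ht, Complex.ofReal_re]

lemma IsFlag.rng_meet_mono (he : IsFlag M T e) {q : H →L[ℂ] H} (hq : IsProjection M q) {s t : ℝ}
    (hs : s ∈ Set.Icc (0 : ℝ) 1) (ht : t ∈ Set.Icc (0 : ℝ) 1) (hst : s ≤ t) :
    rng (meet (e s) q) ≤ rng (meet (e t) q) := by
  rw [rng_meet (he.1 s hs).2 hq.2, rng_meet (he.1 t ht).2 hq.2]
  exact inf_le_inf_right _ (he.2.1 s hs t ht hst)

lemma IsFlag.tr_meet_sub_le (he : IsFlag M T e) {q : H →L[ℂ] H} (hq : IsProjection M q) {s t : ℝ}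
    (hs : s ∈ Set.Icc (0 : ℝ) 1) (ht : t ∈ Set.Icc (0 : ℝ) 1) (hst : s ≤ t) :
    T.tr (meet (e t) q) - T.tr (meet (e s) q) ≤ t - s := by
  have hes := he.1 s hs
  have het := he.1 t ht
  have hmul := (rng_le_iff het.2).1 (he.2.1 s hs t ht hst)
  have hd : IsProjection M (e t - e s) := ⟨sub_mem het.1 hes.1, hes.2.sub het.2 hmul⟩
  have h := TracialState.tr_add_sub_one_le_tr_meet (T := T) (het.meet hq) hd.one_sub
  have hle : T.tr (meet (meet (e t) q) (1 - (e t - e s))) ≤ T.tr (meet (e s) q) := by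
    refine TracialState.tr_mono ((het.meet hq).meet hd.one_sub) (hes.meet hq) ?_
    rw [rng_meet (het.meet hq).2 hd.one_sub.2, rng_meet het.2 hq.2, rng_meet hes.2 hq.2]
    rintro x ⟨⟨hx1, hx2⟩, hx3⟩
    refine ⟨hes.2.mem_rng_iff.2 ?_, hx2⟩
    have h1 := het.2.mem_rng_iff.1 hx1
    have h2 := hd.one_sub.2.mem_rng_iff.1 hx3
    simpa [h1] using h2
  rw [TracialState.tr_sub, TracialState.tr_sub, TracialState.tr_one, he.tr_eq hs,
    he.tr_eq ht] at h
  linarith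

lemma IsFlag.exists_tr_meet_eq (he : IsFlag M T e) {q : H →L[ℂ] H} (hq : IsProjection M q) {x : ℝ}
    (hx0 : 0 ≤ x) (hx1 : x ≤ T.tr q) :
    ∃ t ∈ Set.Icc (0 : ℝ) 1, T.tr (meet (e t) q) = x := by
  have h0m : (0 : ℝ) ∈ Set.Icc (0 : ℝ) 1 := ⟨le_rfl, zero_le_one⟩
  have h1m : (1 : ℝ) ∈ Set.Icc (0 : ℝ) 1 := ⟨zero_le_one, le_rfl⟩
  have hcont : ContinuousOn (fun t => T.tr (meet (e t) q)) (Set.Icc 0 1) := by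
    have hlip {s t : ℝ} (hs : s ∈ Set.Icc (0 : ℝ) 1) (ht : t ∈ Set.Icc (0 : ℝ) 1)
        (hst : s ≤ t) : |T.tr (meet (e t) q) - T.tr (meet (e s) q)| ≤ |t - s| := by
      rw [abs_of_nonneg (sub_nonneg.2 hst), abs_of_nonneg (sub_nonneg.2 (TracialState.tr_mono
        ((he.1 s hs).meet hq) ((he.1 t ht).meet hq) (he.rng_meet_mono hq hs ht hst)))]
      exact he.tr_meet_sub_le hq hs ht hst
    have h1 : LipschitzOnWith 1 (fun t => T.tr (meet (e t) q)) (Set.Icc 0 1) := by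
      refine LipschitzOnWith.of_dist_le_mul fun s hs t ht => ?_
      rw [NNReal.coe_one, one_mul, Real.dist_eq, Real.dist_eq]
      rcases le_total s t with hst | hst
      · rw [abs_sub_comm, abs_sub_comm s]
        exact hlip hs ht hst
      · exact hlip ht hs hst
    exact h1.continuousOn
  have hg0 : T.tr (meet (e 0) q) ≤ 0 := by
    refine (TracialState.tr_mono ((he.1 0 h0m).meet hq) (he.1 0 h0m) ?_).trans_eq (he.tr_eq h0m)
    rw [rng_meet (he.1 0 h0m).2 hq.2]
    exact inf_le_left
  have hg1 : T.tr q ≤ T.tr (meet (e 1) q) := by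
    have := TracialState.tr_add_sub_one_le_tr_meet (T := T) (he.1 1 h1m) hq
    rw [he.tr_eq h1m] at this
    linarith
  exact intermediate_value_Icc zero_le_one hcont ⟨hg0.trans hx0, hx1.trans hg1⟩

/-- The restriction of a flag to a projection `q`, reparametrized by relative trace. -/
lemma IsFlag.exists_restriction (he : IsFlag M T e) {q : H →L[ℂ] H} (hq : IsProjection M q) :
    ∃ h : ℝ → (H →L[ℂ] H),
      (∀ s ∈ Set.Icc (0 : ℝ) 1, IsProjection M (h s) ∧ rng (h s) ≤ rng q ∧
        T.tr (h s) = s * T.tr q) ∧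
      (∀ s ∈ Set.Icc (0 : ℝ) 1, ∀ t ∈ Set.Icc (0 : ℝ) 1, s ≤ t → rng (h s) ≤ rng (h t)) ∧
      (∀ s ∈ Set.Icc (0 : ℝ) 1, ∀ t ∈ Set.Icc (0 : ℝ) 1, s * T.tr q ≤ T.tr (meet (e t) q) →
        rng (h s) ≤ rng (e t)) := by
  have hq0 := TracialState.tr_nonneg (T := T) hq
  have hex (s : ℝ) : ∃ t, s ∈ Set.Icc (0 : ℝ) 1 →
      t ∈ Set.Icc (0 : ℝ) 1 ∧ T.tr (meet (e t) q) = s * T.tr q := by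
    by_cases hs : s ∈ Set.Icc (0 : ℝ) 1
    · obtain ⟨t, ht⟩ := he.exists_tr_meet_eq hq (mul_nonneg hs.1 hq0)
        (mul_le_of_le_one_left hq0 hs.2)
      exact ⟨t, fun _ => ht⟩
    · exact ⟨0, fun h => absurd h hs⟩
  choose θ hθ using hex
  have hcomp {s t : ℝ} (hs : s ∈ Set.Icc (0 : ℝ) 1) (ht : t ∈ Set.Icc (0 : ℝ) 1)
      (hst : T.tr (meet (e s) q) ≤ T.tr (meet (e t) q)) :
      rng (meet (e s) q) ≤ rng (meet (e t) q) := by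
    rcases le_total s t with h | h
    · exact he.rng_meet_mono hq hs ht h
    · exact (congrArg rng (TracialState.eq_of_rng_le_of_tr_le ((he.1 t ht).meet hq)
        ((he.1 s hs).meet hq) (he.rng_meet_mono hq ht hs h) hst)).ge
  refine ⟨fun s => meet (e (θ s)) q, fun s hs => ⟨(he.1 _ (hθ s hs).1).meet hq, ?_, (hθ s hs).2⟩,
    fun s hs t ht hst => hcomp (hθ s hs).1 (hθ t ht).1 ?_, fun s hs t ht hst => ?_⟩
  · rw [rng_meet (he.1 _ (hθ s hs).1).2 hq.2]
    exact inf_le_right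
  · rw [(hθ s hs).2, (hθ t ht).2]
    exact mul_le_mul_of_nonneg_right hst hq0
  · refine (hcomp (hθ s hs).1 ht ((hθ s hs).2.trans_le hst)).trans ?_
    rw [rng_meet (he.1 t ht).2 hq.2]
    exact inf_le_left

end Flag

section Corner

variable {K : Type} [NormedAddCommGroup K] [InnerProductSpace ℂ K] [CompleteSpace K]

open ContinuousLinearMap (adjoint)

/-- The map `x ↦ V x V†`. -/
noncomputable def conj (V : K →L[ℂ] H) (x : K →L[ℂ] K) : H →L[ℂ] H := V ∘L x ∘L adjoint V

variable {V : K →L[ℂ] H}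

@[simp] lemma conj_apply (x : K →L[ℂ] K) (ξ : H) : conj V x ξ = V (x (adjoint V ξ)) := rfl

lemma conj_add (x y : K →L[ℂ] K) : conj V (x + y) = conj V x + conj V y := by ext; simp

lemma conj_smul (c : ℂ) (x : K →L[ℂ] K) : conj V (c • x) = c • conj V x := by ext; simp

lemma conj_zero : conj V 0 = 0 := by ext; simp

lemma conj_one : conj V 1 = V ∘L adjoint V := rfl

lemma conj_star (x : K →L[ℂ] K) : conj V (star x) = star (conj V x) := by
  simp [conj, ContinuousLinearMap.star_eq_adjoint, ContinuousLinearMap.adjoint_comp,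
    ContinuousLinearMap.comp_assoc]

lemma adjoint_apply_self (hV : adjoint V ∘L V = 1) (ξ : K) : adjoint V (V ξ) = ξ := congr($hV ξ)

lemma conj_mul (hV : adjoint V ∘L V = 1) (x y : K →L[ℂ] K) :
    conj V (x * y) = conj V x * conj V y := by
  ext
  simp [adjoint_apply_self hV]

lemma conj_injective (hV : adjoint V ∘L V = 1) : Function.Injective (conj V) := by
  intro x y h
  ext ξ
  have := congr(adjoint V ($h (V ξ)))
  simpa [adjoint_apply_self hV] using this

lemma exists_conj_eq {z : H →L[ℂ] H} (h1 : (V ∘L adjoint V) * z = z)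
    (h2 : z * (V ∘L adjoint V) = z) : ∃ x, conj V x = z := by
  refine ⟨adjoint V ∘L z ∘L V, ?_⟩
  ext ξ
  have h1' := congr($h1 ξ)
  have h2' := congr($h2 ξ)
  simp only [mul_apply_eq_comp, ContinuousLinearMap.comp_apply] at h1' h2'
  simp [h1', h2']

lemma isProj_conj_iff (hV : adjoint V ∘L V = 1) {x : K →L[ℂ] K} :
    IsProj (conj V x) ↔ IsProj x := by
  simp only [IsProj, IsIdempotentElem, IsSelfAdjoint, ← conj_mul hV, ← conj_star,
    (conj_injective hV).eq_iff]

lemma rng_conj_le_iff (hV : adjoint V ∘L V = 1) {x y : K →L[ℂ] K} (hy : IsProj y) :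
    rng (conj V x) ≤ rng (conj V y) ↔ rng x ≤ rng y := by
  rw [rng_le_iff hy, rng_le_iff ((isProj_conj_iff hV).2 hy), ← conj_mul hV,
    (conj_injective hV).eq_iff]

/-- The corner `qMq` of a von Neumann algebra `M` at `q = V V† ∈ M`, acting on the initial space
of the isometry `V`. -/
noncomputable def corner (M : VonNeumannAlgebra H) (V : K →L[ℂ] H) (hV : adjoint V ∘L V = 1)
    (hM : V ∘L adjoint V ∈ M) : VonNeumannAlgebra K where
  carrier := {x | conj V x ∈ M}
  mul_mem' {x y} hx hy := by
    rw [Set.mem_ofPred_eq, conj_mul hV]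
    exact mul_mem hx hy
  one_mem' := hM
  add_mem' {x y} hx hy := by
    rw [Set.mem_ofPred_eq, conj_add]
    exact add_mem hx hy
  zero_mem' := by
    rw [Set.mem_ofPred_eq, conj_zero]
    exact zero_mem M
  algebraMap_mem' c := by
    rw [Set.mem_ofPred_eq, Algebra.algebraMap_eq_smul_one, conj_smul, conj_one]
    exact M.toStarSubalgebra.smul_mem hM c
  star_mem' {x} hx := by
    rw [Set.mem_ofPred_eq, conj_star]
    exact star_mem hx
  centralizer_centralizer' := by
    refine subset_antisymm (fun y hy => ?_) Set.subset_centralizer_centralizer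
    rw [Set.mem_ofPred_eq, ← M.commutant_commutant, VonNeumannAlgebra.mem_commutant_iff]
    intro m hm
    have hmq (ξ : H) : V (adjoint V (m ξ)) = m (V (adjoint V ξ)) :=
      apply_comm_of_mem_commutant hM hm ξ
    have hcomm : y ∘L (adjoint V ∘L m ∘L V) = (adjoint V ∘L m ∘L V) ∘L y := by
      refine (hy (adjoint V ∘L m ∘L V) fun x hx => ?_).symm
      ext ξ
      have := congr(adjoint V $(apply_comm_of_mem_commutant hx hm (V ξ)))
      simpa [adjoint_apply_self hV] using this
    ext ξ
    have h1 := congr(V ($hcomm (adjoint V ξ)))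
    simp only [ContinuousLinearMap.comp_apply] at h1
    rw [← hmq, adjoint_apply_self hV, hmq, adjoint_apply_self hV] at h1
    exact h1.symm

variable {M : VonNeumannAlgebra H} {T : TracialState M}

lemma mem_corner {hV : adjoint V ∘L V = 1} {hM : V ∘L adjoint V ∈ M} {x : K →L[ℂ] K} :
    x ∈ corner M V hV hM ↔ conj V x ∈ M := Iff.rfl

lemma isProjection_corner {hV : adjoint V ∘L V = 1} {hM : V ∘L adjoint V ∈ M} {x : K →L[ℂ] K} :
    IsProjection (corner M V hV hM) x ↔ IsProjection M (conj V x) := by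
  rw [IsProjection, IsProjection, mem_corner, isProj_conj_iff hV]

/-- The normalized trace on a corner of trace `c > 0`. -/
noncomputable def cornerTrace (T : TracialState M) (hV : adjoint V ∘L V = 1)
    (hM : V ∘L adjoint V ∈ M) {c : ℝ} (hc : 0 < c) (hTc : T.τ (V ∘L adjoint V) = c) :
    TracialState (corner M V hV hM) where
  τ x := (c⁻¹ : ℝ) * T.τ (conj V x)
  map_add a b := by rw [conj_add, T.map_add, mul_add]
  map_smul z a := by rw [conj_smul, T.map_smul, mul_left_comm]
  tracial a b ha hb := by rw [conj_mul hV, conj_mul hV, T.tracial _ _ ha hb]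
  pos a ha := by
    rw [conj_mul hV, conj_star]
    exact mul_nonneg (by simpa using hc.le) (T.pos _ ha)
  faithful a ha h := by
    rw [conj_mul hV, conj_star, mul_eq_zero] at h
    refine conj_injective hV ((T.faithful _ ha (h.resolve_left ?_)).trans conj_zero.symm)
    simpa using hc.ne'
  normalized := by
    rw [conj_one, hTc, ← Complex.ofReal_mul, inv_mul_cancel₀ hc.ne', Complex.ofReal_one]

lemma cornerTrace_τ (hV : adjoint V ∘L V = 1) (hM : V ∘L adjoint V ∈ M) {c : ℝ} (hc : 0 < c)
    (hTc : T.τ (V ∘L adjoint V) = c) (x : K →L[ℂ] K) :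
    (cornerTrace T hV hM hc hTc).τ x = (c⁻¹ : ℝ) * T.τ (conj V x) := rfl

lemma IsFlag.exists_corner_flag {e : ℝ → (H →L[ℂ] H)} (he : IsFlag M T e)
    (hV : adjoint V ∘L V = 1) (hM : V ∘L adjoint V ∈ M) (hq : IsProjection M (V ∘L adjoint V))
    {c : ℝ} (hc : 0 < c) (hTc : T.τ (V ∘L adjoint V) = c) :
    ∃ h, IsFlag (corner M V hV hM) (cornerTrace T hV hM hc hTc) h ∧
      ∀ s ∈ Set.Icc (0 : ℝ) 1, ∀ t ∈ Set.Icc (0 : ℝ) 1,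
        s * c ≤ T.tr (meet (e t) (V ∘L adjoint V)) → rng (conj V (h s)) ≤ rng (e t) := by
  have htr : T.tr (V ∘L adjoint V) = c := by rw [TracialState.tr, hTc, Complex.ofReal_re]
  obtain ⟨h, hproj, hmono, hle⟩ := he.exists_restriction hq
  have hex (s : ℝ) : ∃ x, s ∈ Set.Icc (0 : ℝ) 1 → conj V x = h s := by
    by_cases hs : s ∈ Set.Icc (0 : ℝ) 1
    · obtain ⟨hp, hpq, -⟩ := hproj s hs
      have h1 := (rng_le_iff hq.2).1 hpq
      obtain ⟨x, hx⟩ := exists_conj_eq h1 (hp.2.mul_comm_of_mul_eq hq.2 h1)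
      exact ⟨x, fun _ => hx⟩
    · exact ⟨0, fun h => absurd h hs⟩
  choose k hk using hex
  have hkp (s) (hs : s ∈ Set.Icc (0 : ℝ) 1) : IsProjection (corner M V hV hM) (k s) :=
    isProjection_corner.2 ((hk s hs).symm ▸ (hproj s hs).1)
  refine ⟨k, ⟨hkp, fun s hs t ht hst => ?_, fun t ht => ?_⟩, fun s hs t ht hst => ?_⟩
  · rw [← rng_conj_le_iff hV (hkp t ht).2, hk s hs, hk t ht]
    exact hmono s hs t ht hst
  · rw [cornerTrace_τ, hk t ht, TracialState.τ_eq_tr (hproj t ht).1, (hproj t ht).2.2, htr,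
      ← Complex.ofReal_mul, mul_comm t, inv_mul_cancel_left₀ hc.ne']
  · rw [hk s hs]
    exact hle s hs t ht (htr.symm ▸ hst)

end Corner

section Reduction

open ContinuousLinearMap (adjoint)

lemma exists_isometry_of_isProj {q : H →L[ℂ] H} (hq : IsProj q) :
    ∃ (K : Submodule ℂ H) (_ : CompleteSpace K) (V : K →L[ℂ] H),
      adjoint V ∘L V = 1 ∧ V ∘L adjoint V = q := by
  have hK : CompleteSpace (rng q) := hq.isClosed_rng.completeSpace_coe
  refine ⟨rng q, hK, (rng q).subtypeL, ?_, ?_⟩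
  · ext ξ
    rw [Submodule.adjoint_subtypeL]
    exact congrArg Subtype.val ((rng q).orthogonalProjectionOnto_mem_subspace_eq_self ξ)
  · ext ξ
    rw [Submodule.adjoint_subtypeL]
    have h : (rng q).starProjection ξ = q ξ := by
      refine Submodule.eq_starProjection_of_mem_of_inner_eq_zero ⟨ξ, rfl⟩ fun w hw => ?_
      rw [← hq.mem_rng_iff.1 hw, ← ContinuousLinearMap.adjoint_inner_left,
        ← ContinuousLinearMap.star_eq_adjoint, hq.2.star_eq, map_sub]
      have : q (q ξ) = q ξ := congr($(hq.1.eq) ξ)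
      rw [this, sub_self, inner_zero_left]
    exact h

lemma exists_projection_ge {M : VonNeumannAlgebra H} {T : TracialState M} {e : ℝ → (H →L[ℂ] H)}
    (he : IsFlag M T e) {a b d : H →L[ℂ] H} (ha : IsProjection M a) (hb : IsProjection M b)
    (hd : IsProjection M d) {c : ℝ} (hc1 : c ≤ 1) (hc : T.tr a + T.tr b + T.tr d ≤ c) :
    ∃ q, IsProjection M q ∧ rng a ≤ rng q ∧ rng b ≤ rng q ∧ rng d ≤ rng q ∧ T.tr q = c := by
  have hab := ha.one_sub.meet hb.one_sub
  have hz := hab.meet hd.one_sub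
  have h1 := TracialState.tr_add_sub_one_le_tr_meet (T := T) ha.one_sub hb.one_sub
  have h2 := TracialState.tr_add_sub_one_le_tr_meet (T := T) hab hd.one_sub
  simp only [TracialState.tr_sub, TracialState.tr_one] at h1 h2
  obtain ⟨t, ht, htr⟩ := he.exists_tr_meet_eq hz (x := 1 - c) (by linarith) (by linarith)
  have hp := (he.1 t ht).meet hz
  have hle : rng (meet (e t) (meet (meet (1 - a) (1 - b)) (1 - d))) ≤
      (rng (1 - a) ⊓ rng (1 - b)) ⊓ rng (1 - d) := by
    rw [rng_meet (he.1 t ht).2 hz.2, rng_meet hab.2 hd.one_sub.2,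
      rng_meet ha.one_sub.2 hb.one_sub.2]
    exact inf_le_right
  have key {x : H →L[ℂ] H} (hx : IsProjection M x) {p : H →L[ℂ] H} (hp : IsProjection M p)
      (h : rng p ≤ rng (1 - x)) : rng x ≤ rng (1 - p) := by
    rw [rng_le_iff hx.2.one_sub] at h
    have h' := hp.2.mul_comm_of_mul_eq hx.2.one_sub h
    rw [rng_le_iff hp.2.one_sub]
    rw [mul_sub, mul_one, sub_eq_self] at h'
    rw [sub_mul, one_mul, h', sub_zero]
  refine ⟨1 - _, hp.one_sub, key ha hp (hle.trans (inf_le_left.trans inf_le_left)),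
    key hb hp (hle.trans (inf_le_left.trans inf_le_right)), key hd hp (hle.trans inf_le_right), ?_⟩
  rw [TracialState.tr_sub, TracialState.tr_one, htr]
  ring

lemma le_of_forall_lt_succ {r : ℕ} {i : ℕ → ℕ} (hi0 : i 0 = 0)
    (himono : ∀ y, 1 ≤ y → y < r → i y < i (y + 1)) {x y : ℕ} (hxy : x ≤ y) (hy : y ≤ r) :
    i x ≤ i y := by
  induction y, hxy using Nat.le_induction with
  | base => exact le_rfl
  | succ y hxy ih =>
    refine (ih (by omega)).trans ?_
    rcases Nat.eq_zero_or_pos y with rfl | h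
    · simp [hi0]
    · exact (himono y h (by omega)).le

/-- The trace of `e_{i'_ℓ/(n+1)} ∧ q` for a projection `q` of trace `n/(n+1)` that dominates
`e_{i_u/(n+1)}`. -/
lemma IsFlag.le_tr_meet_shift {M : VonNeumannAlgebra H} {T : TracialState M}
    {e : ℝ → (H →L[ℂ] H)} (he : IsFlag M T e) {q : H →L[ℂ] H} (hq : IsProjection M q) {n a b : ℕ}
    (ha : a ≤ n) (hb : b ≤ n) (hTq : T.tr q = (n : ℝ) / (n + 1 : ℕ))
    (hle : rng (e ((b : ℝ) / (n + 1 : ℕ))) ≤ rng q) {P : Prop} [Decidable P] (hP : ¬P → a ≤ b) :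
    (a : ℝ) / n * ((n : ℝ) / (n + 1 : ℕ)) ≤
      T.tr (meet (e (((a + if P then 1 else 0 : ℕ) : ℝ) / (n + 1 : ℕ))) q) := by
  have hmem {m : ℕ} (hm : m ≤ n + 1) : (m : ℝ) / (n + 1 : ℕ) ∈ Set.Icc (0 : ℝ) 1 :=
    ⟨by positivity, div_le_one_of_le₀ (by exact_mod_cast hm) (by positivity)⟩
  have hmul : (a : ℝ) / n * ((n : ℝ) / (n + 1 : ℕ)) = a / (n + 1 : ℕ) := by
    rcases Nat.eq_zero_or_pos n with rfl | hn
    · simp [Nat.le_zero.1 ha]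
    · have : (n : ℝ) ≠ 0 := by positivity
      field_simp
  rw [hmul]
  by_cases h : P
  · rw [if_pos h]
    have ht := hmem (m := a + 1) (by omega)
    have h1 := TracialState.tr_add_sub_one_le_tr_meet (T := T) (he.1 _ ht) hq
    rw [he.tr_eq ht, hTq] at h1
    refine le_of_eq_of_le ?_ h1
    push_cast
    field_simp
    ring
  · rw [if_neg h, add_zero]
    have ht := hmem (m := a) (by omega)
    have hs := hmem (m := b) (by omega)
    refine (he.tr_eq ht).symm.trans_le (TracialState.tr_mono (he.1 _ ht) ((he.1 _ ht).meet hq) ?_)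
    rw [rng_meet (he.1 _ ht).2 hq.2]
    exact le_inf le_rfl ((he.2.1 _ ht _ hs (by have := hP h; gcongr)).trans hle)

lemma exists_meet_of_corner_meet {K : Type} [NormedAddCommGroup K] [InnerProductSpace ℂ K]
    [CompleteSpace K] {V : K →L[ℂ] H} {M : VonNeumannAlgebra H} {T : TracialState M}
    {hV : adjoint V ∘L V = 1} {hM : V ∘L adjoint V ∈ M} {c : ℝ} {hc : 0 < c}
    {hTc : T.τ (V ∘L adjoint V) = c} {x : H →L[ℂ] H} (hx : IsProjection M x) {y p : K →L[ℂ] K}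
    (hy : IsProjection (corner M V hV hM) y) (hp : IsProjection (corner M V hV hM) p)
    (hyx : rng (conj V y) ≤ rng x) {a b : ℝ} (hab : b = c * a)
    (h : ∃ q, q ∈ corner M V hV hM ∧ IsMeetOf q y p ∧ (a : ℂ) ≤ (cornerTrace T hV hM hc hTc).τ q) :
    ∃ q, q ∈ M ∧ IsMeetOf q x (conj V p) ∧ (b : ℂ) ≤ T.τ q := by
  obtain ⟨q, hqM, ⟨hq, hrq⟩, hle⟩ := h
  have hq' : IsProjection M (conj V q) := isProjection_corner.1 ⟨hqM, hq⟩
  have hp' : IsProjection M (conj V p) := isProjection_corner.1 hp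
  have hm := hx.meet hp'
  refine ⟨meet x (conj V p), hm.1, ⟨hm.2, rng_meet hx.2 hp'.2⟩, ?_⟩
  have hmono : T.tr (conj V q) ≤ T.tr (meet x (conj V p)) := by
    refine TracialState.tr_mono hq' hm ?_
    rw [rng_meet hx.2 hp'.2]
    exact le_inf (((rng_conj_le_iff hV hy.2).2 (hrq.trans_le inf_le_left)).trans hyx)
      ((rng_conj_le_iff hV hp.2).2 (hrq.trans_le inf_le_right))
  rw [cornerTrace_τ, TracialState.τ_eq_tr hq', ← Complex.ofReal_mul, Complex.real_le_real,
    le_inv_mul_iff₀ hc] at hle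
  rw [TracialState.τ_eq_tr hm, Complex.real_le_real, hab]
  exact hle.trans hmono

end Reduction

end Paper

/-- TT-reduction for property `Pₙ`.  Let `(I,J,K)` be a triple of `r`-element subsets of
`{1,…,n}` (written `I = {i₁<⋯<i_r}`, etc., with `i₀ = j₀ = k₀ = 0`) having property `Pₙ`,
and suppose `u,v,w ∈ {0,…,r}` satisfy `i_u + j_v + k_w ≤ n`.  Define
`i'_y = i_y + [y > u]`, `j'_y = j_y + [y > v]`, `k'_y = k_y + [y > w]`.  Then the triple
`(I',J',K')` of subsets of `{1,…,n+1}` has property `P_{n+1}`. -/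
theorem propertyP_reduction (n r : ℕ) (hr : 1 ≤ r) (hrn : r ≤ n)
    (i j k : ℕ → ℕ)
    (hi0 : i 0 = 0) (hj0 : j 0 = 0) (hk0 : k 0 = 0)
    (hi : ∀ y, 1 ≤ y → y ≤ r → 1 ≤ i y ∧ i y ≤ n)
    (hj : ∀ y, 1 ≤ y → y ≤ r → 1 ≤ j y ∧ j y ≤ n)
    (hk : ∀ y, 1 ≤ y → y ≤ r → 1 ≤ k y ∧ k y ≤ n)
    (himono : ∀ y, 1 ≤ y → y < r → i y < i (y + 1))
    (hjmono : ∀ y, 1 ≤ y → y < r → j y < j (y + 1))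
    (hkmono : ∀ y, 1 ≤ y → y < r → k y < k (y + 1))
    (hP : Paper.PropertyP n r i j k)
    (u v w : ℕ) (hu : u ≤ r) (hv : v ≤ r) (hw : w ≤ r)
    (hsum : i u + j v + k w ≤ n) :
    Paper.PropertyP (n + 1) r
      (fun y => i y + if u < y then 1 else 0)
      (fun y => j y + if v < y then 1 else 0)
      (fun y => k y + if w < y then 1 else 0) := by
  intro H _ _ _ M T e f g he hf hg
  have hmem {m N : ℕ} (hm : m ≤ N) : (m : ℝ) / N ∈ Set.Icc (0 : ℝ) 1 :=
    ⟨by positivity, div_le_one_of_le₀ (by exact_mod_cast hm) (by positivity)⟩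
  have hn : (0 : ℝ) < n := by exact_mod_cast hr.trans hrn
  have hc : (0 : ℝ) < (n : ℝ) / (n + 1 : ℕ) := by positivity
  have hu' := hmem (m := i u) (N := n + 1) (by omega)
  have hv' := hmem (m := j v) (N := n + 1) (by omega)
  have hw' := hmem (m := k w) (N := n + 1) (by omega)
  obtain ⟨q, hq, hqe, hqf, hqg, hTq⟩ := Paper.exists_projection_ge he (he.1 _ hu') (hf.1 _ hv')
    (hg.1 _ hw') (hmem (N := n + 1) n.le_succ).2 (by
      rw [he.tr_eq hu', hf.tr_eq hv', hg.tr_eq hw', ← add_div, ← add_div]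
      gcongr
      exact_mod_cast hsum)
  obtain ⟨K, _, V, hV, rfl⟩ := Paper.exists_isometry_of_isProj hq.2
  have hTc := Paper.TracialState.τ_eq_tr (T := T) hq
  rw [hTq] at hTc
  obtain ⟨e', he', hee'⟩ := he.exists_corner_flag hV hq.1 hq hc hTc
  obtain ⟨f', hf', hff'⟩ := hf.exists_corner_flag hV hq.1 hq hc hTc
  obtain ⟨g', hg', hgg'⟩ := hg.exists_corner_flag hV hq.1 hq hc hTc
  obtain ⟨p, hp, hTp, hmeet⟩ := hP K _ _ e' f' g' he' hf' hg'
  have hp' := Paper.isProjection_corner.1 hp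
  refine ⟨Paper.conj V p, hp', ?_, fun ℓ h1 h2 => ?_⟩
  · rw [Paper.cornerTrace_τ, Paper.TracialState.τ_eq_tr hp', ← Complex.ofReal_mul,
      Complex.ofReal_inj, inv_mul_eq_iff_eq_mul₀ hc.ne'] at hTp
    rw [Paper.TracialState.τ_eq_tr hp', hTp, Complex.ofReal_inj]
    field_simp
  · have hℓ : (ℓ : ℝ) / (n + 1 : ℕ) = (n : ℝ) / (n + 1 : ℕ) * (ℓ / n) := by field_simp
    have hlift {e : ℝ → (H →L[ℂ] H)} (he : Paper.IsFlag M T e) {e' : ℝ → (K →L[ℂ] K)}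
        (he' : Paper.IsFlag _ (Paper.cornerTrace T hV hq.1 hc hTc) e')
        (hee' : ∀ s ∈ Set.Icc (0 : ℝ) 1, ∀ t ∈ Set.Icc (0 : ℝ) 1,
          s * ((n : ℝ) / (n + 1 : ℕ)) ≤
            T.tr (Paper.meet (e t) (V ∘L ContinuousLinearMap.adjoint V)) →
          Paper.rng (Paper.conj V (e' s)) ≤ Paper.rng (e t)) {i : ℕ → ℕ} {u : ℕ} (hi0 : i 0 = 0)
        (hi : ∀ y, 1 ≤ y → y ≤ r → 1 ≤ i y ∧ i y ≤ n)
        (himono : ∀ y, 1 ≤ y → y < r → i y < i (y + 1)) (hu : u ≤ r) (hb : i u ≤ n)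
        (hqe : Paper.rng (e ((i u : ℝ) / (n + 1 : ℕ))) ≤
          Paper.rng (V ∘L ContinuousLinearMap.adjoint V))
        (h : ∃ q, q ∈ Paper.corner M V hV hq.1 ∧ Paper.IsMeetOf q (e' ((i ℓ : ℝ) / n)) p ∧
          (((ℓ : ℝ) / n : ℝ) : ℂ) ≤ (Paper.cornerTrace T hV hq.1 hc hTc).τ q) :
        ∃ q, q ∈ M ∧ Paper.IsMeetOf q
          (e (((i ℓ + if u < ℓ then 1 else 0 : ℕ) : ℝ) / (n + 1 : ℕ))) (Paper.conj V p) ∧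
          (((ℓ : ℝ) / (n + 1 : ℕ) : ℝ) : ℂ) ≤ T.τ q := by
      have ha := (hi ℓ h1 h2).2
      have ht := hmem (m := i ℓ + if u < ℓ then 1 else 0) (N := n + 1) (by split_ifs <;> omega)
      refine Paper.exists_meet_of_corner_meet (he.1 _ ht) (he'.1 _ (hmem ha)) hp
        (hee' _ (hmem ha) _ ht ?_) hℓ h
      exact he.le_tr_meet_shift hq ha hb hTq hqe fun h =>
        Paper.le_of_forall_lt_succ hi0 himono (not_lt.1 h) hu
    obtain ⟨m1, m2, m3⟩ := hmeet ℓ h1 h2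
    exact ⟨hlift he he' hee' hi0 hi himono hu (by omega) hqe m1,
      hlift hf hf' hff' hj0 hj hjmono hv (by omega) hqf m2,
      hlift hg hg' hgg' hk0 hk hkmono hw (by omega) hqg m3⟩
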